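/- There exists an observable sticker system φ = (γ, A), with γ a simple regular sticker system, such that the (unfiltered) language L(φ) is not recursive (not decidable). (This follows from the computational completeness of observable sticker systems with ⊥-filtering together with the closure of recursive languages under intersection with regular languages.) -/

import Mathlib

/-!  Common definitions for (simple regular) sticker systems and observable sticker systems. -/

/-- A molecule over `V`: an upper strand and a lower strand. -/
abbrev Molecule (V : Type) := List V × List V

/-- A single strand: one of the two strands is empty. -/
def IsSingleStrand {V : Type} (m : Molecule V) : Prop := m.1 = [] ∨ m.2 = []

/-- A complete molecule (an element of `WK_ρ(V)`): both strands have the same length and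
all paired positions satisfy the complementarity relation `ρ`. -/
def IsCompleteMolecule {V : Type} (ρ : V → V → Prop) (m : Molecule V) : Prop :=
  List.Forall₂ ρ m.1 m.2

/-- A well-started molecule (an element of `R_ρ(V) = WK_ρ(V)·S(V)`): a complete
double-stranded part followed by an overhang on the right, which is a single upper or
lower strand. -/
def IsWellStarted {V : Type} (ρ : V → V → Prop) (m : Molecule V) : Prop :=
  ∃ u₁ u₂ v : List V, List.Forall₂ ρ u₁ u₂ ∧
    (m = (u₁ ++ v, u₂) ∨ m = (u₁, u₂ ++ v))

/-- A sticker system: a complementarity relation, a set of axioms and a set of dominoes. -/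
structure StickerSystem (V : Type) where
  /-- The complementarity relation `ρ`. -/
  compl : V → V → Prop
  /-- The set `X` of axioms. -/
  axioms : Set (Molecule V)
  /-- The set `D` of dominoes. -/
  dominoes : Set (Molecule V)

/-- `γ` is a simple regular sticker system: `ρ` is symmetric, the axioms form a finite set
of well-started molecules and the dominoes form a finite set of single strands. -/
def StickerSystem.IsSimpleRegular {V : Type} (γ : StickerSystem V) : Prop :=
  (∀ a b : V, γ.compl a b → γ.compl b a) ∧
  γ.axioms.Finite ∧ (∀ m ∈ γ.axioms, IsWellStarted γ.compl m) ∧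
  γ.dominoes.Finite ∧ (∀ m ∈ γ.dominoes, IsSingleStrand m)

/-- One sticking step `u ⇒ w`: some domino `v ∈ D` is attached to the right end of `u`
(concatenating its strand to the corresponding strand of `u`), the result being again a
well-started molecule (so all newly paired positions satisfy `ρ`). -/
def StickerSystem.Step {V : Type} (γ : StickerSystem V) (u w : Molecule V) : Prop :=
  ∃ v ∈ γ.dominoes, w = (u.1 ++ v.1, u.2 ++ v.2) ∧ IsWellStarted γ.compl w

/-- A complete computation of `γ`: a sequence `w₁ ⇒ w₂ ⇒ ⋯ ⇒ w_k` of sticking steps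
starting in an axiom and ending in a complete molecule. -/
def StickerSystem.CompleteComputation {V : Type} (γ : StickerSystem V)
    (ws : List (Molecule V)) : Prop :=
  (∃ a ∈ γ.axioms, ws.head? = some a) ∧
  List.Chain' γ.Step ws ∧
  ∃ m : Molecule V, ws.getLast? = some m ∧ IsCompleteMolecule γ.compl m

/-- The language generated by a sticker system: the set of upper strands of the final
complete molecules of all complete computations of `γ`. -/
def StickerSystem.language {V : Type} (γ : StickerSystem V) : Language V :=
  { x | ∃ ws : List (Molecule V), γ.CompleteComputation ws ∧
      ∃ m : Molecule V, ws.getLast? = some m ∧ m.1 = x }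

/-- The encoding of a molecule as a string over the double-symbol alphabet
`V_d` (modelled inside `Option V × Option V`): position `i` carries the pair of the `i`-th
upper and lower symbols, `none` marking an absent symbol in an overhang. -/
def encodeMolecule {V : Type} (m : Molecule V) : List (Option V × Option V) :=
  (List.range (max m.1.length m.2.length)).map fun i => (m.1[i]?, m.2[i]?)

/-- Every fiber of the observer map is a regular language (and the fibers obviously
partition the set of all strings): this characterizes maps computed by complete
deterministic finite automata with output-labelled states, i.e. monadic transducers. -/
def ObserverRegular {V Γ : Type*} (A : List V → Option Γ) : Prop :=
  ∀ o : Option Γ, Language.IsRegular ({ w : List V | A w = o } : Language V)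

/-- The language `L(φ)` of the observable sticker system `φ = (γ, A)`, a language over
`Σ ∪ {⊥}` (= `Option Sig`, `none` being `⊥`): all concatenations `A(w₁)A(w₂)⋯A(w_k)` of
observer outputs along complete computations `(w_i)_{1 ≤ i ≤ k}` of `γ` (the observer reads
molecules encoded over the double-symbol alphabet; output `none` of `A` is the empty
word `λ`). -/
def obsStickerLang {V Sig : Type} (γ : StickerSystem V)
    (A : List (Option V × Option V) → Option (Option Sig)) : Language (Option Sig) :=
  { x | ∃ ws : List (Molecule V), γ.CompleteComputation ws ∧
      x = (ws.map fun w => (A (encodeMolecule w)).toList).flatten }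

/-- The language `L_⊥(φ) = L(φ) ∩ Σ*`: the words of `L(φ)` containing no `⊥`, viewed as a
language over `Σ`. -/
def obsStickerLangBot {V Sig : Type} (γ : StickerSystem V)
    (A : List (Option V × Option V) → Option (Option Sig)) : Language Sig :=
  { x | (x.map some) ∈ obsStickerLang γ A }

open Turing in
theorem part1_f : ∃ f : ℕ →. ℕ, Partrec f ∧ ¬ ComputablePred fun k => (f k).Dom := by
  refine ⟨fun n => Nat.Partrec.Code.eval (Denumerable.ofNat Nat.Partrec.Code n) 0, ?_, ?_⟩
  · exact Nat.Partrec.Code.eval_part.comp (Computable.ofNat _) (Computable.const 0)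
  · intro h
    apply ComputablePred.halting_problem 0
    refine ComputablePred.computable_of_manyOneReducible ⟨Encodable.encode, Computable.encode, ?_⟩ h
    intro c
    simp

theorem part1_pow : Primrec₂ (fun a b : ℕ => a ^ b) := by
  have : Primrec₂ (fun a b : ℕ => Nat.rec (motive := fun _ => ℕ) 1 (fun _ ih => ih * a) b) := by
    refine Primrec.nat_rec (f := fun _ : ℕ => 1) (g := fun (a : ℕ) (p : ℕ × ℕ) => p.2 * a) ?_ ?_
    · exact Primrec.const 1
    · exact Primrec.nat_mul.comp (Primrec.snd.comp Primrec.snd) Primrec.fst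
  refine this.of_eq ?_
  intro a b
  induction b with
  | zero => rfl
  | succ b ih => simp only [pow_succ, ← ih]

theorem part1_g : ∃ g : ℕ →. ℕ, Partrec g ∧ ¬ ComputablePred fun k => (g (2 ^ k)).Dom := by
  obtain ⟨f, hf, hn⟩ := part1_f
  refine ⟨fun m => (Nat.rfind fun k => Part.some (decide (2 ^ k = m))).bind f, ?_, ?_⟩
  · refine Partrec.bind (Partrec.rfind ?_) (hf.comp Computable.snd)
    refine Computable.partrec ?_
    refine Primrec.to_comp ?_
    exact (PrimrecRel.decide Primrec.eq).comp (part1_pow.comp (Primrec.const 2) Primrec.snd) Primrec.fst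
  · convert hn using 3 with k
    have : (Nat.rfind (fun k_1 => Part.some (decide (2 ^ k_1 = 2 ^ k)) : ℕ →. Bool)) = Part.some k := by
      apply Part.eq_some_iff.2
      refine Nat.mem_rfind.2 ?_
      constructor
      · simp
      · intro m hm
        simp [hm.ne]
    change (Part.bind (Nat.rfind (fun k_1 => Part.some (decide (2 ^ k_1 = 2 ^ k)) : ℕ →. Bool)) f).Dom ↔ _
    rw [this]
    erw [Part.bind_some]

open Turing in
theorem part1_trNat (k : ℕ) :
    PartrecToTM2.trNat (2 ^ k) = List.replicate k PartrecToTM2.Γ'.bit0 ++ [PartrecToTM2.Γ'.bit1] := by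
  have h1 : ∃ p : PosNum, (p : ℕ) = 2 ^ k ∧
      PartrecToTM2.trPosNum p = List.replicate k PartrecToTM2.Γ'.bit0 ++ [PartrecToTM2.Γ'.bit1] := by
    induction k with
    | zero => exact ⟨PosNum.one, rfl, rfl⟩
    | succ k ih =>
      obtain ⟨p, hp, hq⟩ := ih
      refine ⟨p.bit0, ?_, ?_⟩
      · rw [PosNum.cast_bit0, hp, pow_succ]; omega
      · rw [PartrecToTM2.trPosNum, hq, List.replicate_succ]; rfl
  obtain ⟨p, hp, hq⟩ := h1
  have : ((2 ^ k : ℕ) : Num) = Num.pos p := by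
    rw [← hp, ← Num.cast_pos, Num.of_to_nat]
  rw [PartrecToTM2.trNat, this]
  exact hq

open Turing in
theorem part1 : ∃ (Γ Λ : Type) (_ : Inhabited Γ) (_ : Inhabited Λ) (_ : Finite Γ)
    (M : TM0.Machine Γ Λ) (S : Set Λ) (X B C : Γ), S.Finite ∧ TM0.Supports M S ∧
    ¬ ComputablePred fun k : ℕ => (TM0.eval M (X :: B :: List.replicate k C)).Dom := by
  obtain ⟨g, hg, hn⟩ := part1_g
  obtain ⟨c, hc⟩ := ToPartrec.Code.exists_code (Nat.Partrec'.part_iff₁.2 hg)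
  let _ : Inhabited PartrecToTM2.Λ' := ⟨PartrecToTM2.trNormal c PartrecToTM2.Cont'.halt⟩
  let M2 := PartrecToTM2.tr
  let M1 := TM2to1.tr M2
  let M0 := TM1to0.tr M1
  have s2 := PartrecToTM2.tr_supports c PartrecToTM2.Cont'.halt
  have s1 := TM2to1.tr_supports M2 s2
  have s0 := TM1to0.tr_supports M1 s1
  let e : PartrecToTM2.Γ' → TM2to1.Γ' PartrecToTM2.K' (fun _ => PartrecToTM2.Γ') :=
    fun a => (false, Function.update (fun _ => none) PartrecToTM2.K'.main (some a))
  let X : TM2to1.Γ' PartrecToTM2.K' (fun _ => PartrecToTM2.Γ') :=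
    (true, Function.update (fun _ => none) PartrecToTM2.K'.main (some .cons))
  refine ⟨_, _, inferInstance, inferInstance, ?_, M0, _, X, e .bit1, e .bit0, Finset.finite_toSet _, s0, ?_⟩
  · unfold TM2to1.Γ'
    have : Finite PartrecToTM2.K' := Finite.of_injective
      (fun k : PartrecToTM2.K' => (match k with | .main => 0 | .rev => 1 | .aux => 2 | .stack => 3 : Fin 4)) (by
        intro a b h; cases a <;> cases b <;> simp_all)
    have : Finite (PartrecToTM2.K' → Option PartrecToTM2.Γ') := inferInstance
    exact (inferInstance : Finite (Bool × (PartrecToTM2.K' → Option PartrecToTM2.Γ')))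
  · convert hn using 3 with k
    rw [TM1to0.tr_eval]
    have hL : X :: e .bit1 :: List.replicate k (e .bit0) =
      TM2to1.trInit PartrecToTM2.K'.main (PartrecToTM2.trList [2 ^ k]) := by
      have hr : (PartrecToTM2.trList [2 ^ k]).reverse =
          .cons :: .bit1 :: List.replicate k PartrecToTM2.Γ'.bit0 := by
        simp [PartrecToTM2.trList, part1_trNat]
      have h1 : TM2to1.trInit (Γ := fun _ => PartrecToTM2.Γ') PartrecToTM2.K'.main
          (PartrecToTM2.trList [2 ^ k]) =
          (true, (((PartrecToTM2.trList [2 ^ k]).reverse.map e).headI).2) ::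
            ((PartrecToTM2.trList [2 ^ k]).reverse.map e).tail := rfl
      rw [h1, hr, ← List.map_replicate]
      rfl
    rw [hL]
    refine (TM2to1.tr_eval_dom M2 _ _).trans ?_
    have := PartrecToTM2.tr_eval c [2 ^ k]
    have h2 := hc ⟨[2 ^ k], rfl⟩
    have hi : PartrecToTM2.init c [2 ^ k] = TM2.init PartrecToTM2.K'.main (PartrecToTM2.trList [2 ^ k]) := by
      unfold PartrecToTM2.init TM2.init
      congr 1
      funext k
      cases k <;> rfl
    rw [hi] at this
    unfold TM2.eval
    rw [Part.map_Dom]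
    erw [this]
    rw [h2]
    rfl


def QStep {Q I : Type} (v u : I → List Q) (w w2 : List Q) : Prop :=
  ∃ i w', w = v i ++ w' ∧ w2 = w' ++ u i

def QAcc {Q I : Type} (v u : I → List Q) (w : List Q) : Prop :=
  ∃ i, Relation.ReflTransGen (QStep v u) w (v i)

inductive TQ (Γ Λ : Type)
  | sym : Γ → TQ Γ Λ
  | hd : Λ → Γ → TQ Γ Λ
  | rt : TQ Γ Λ
  | lt : TQ Γ Λ
  | ht : TQ Γ Λ

theorem TQ.finite (Γ Λ : Type) [Finite Γ] [Finite Λ] : Finite (TQ Γ Λ) := by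
  refine Finite.of_injective (fun x : TQ Γ Λ => (match x with
    | .sym a => .inl a
    | .hd q a => .inr (.inl (q, a))
    | .rt => .inr (.inr 0)
    | .lt => .inr (.inr 1)
    | .ht => .inr (.inr 2) : Γ ⊕ (Λ × Γ) ⊕ Fin 3)) ?_
  intro a b h
  cases a <;> cases b <;> simp_all

section tmq
open Turing

inductive Tile {Γ Λ : Type} [Inhabited Γ] [Inhabited Λ] (M : TM0.Machine Γ Λ) (S : Set Λ) :
    List (TQ Γ S) → List (TQ Γ S) → Prop
  | copy (x) : Tile M S [x] [x]
  | write (q q' : S) (a b : Γ) : M q a = some (q'.1, .write b) → Tile M S [.hd q a] [.hd q' b]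
  | right (q q' : S) (a b : Γ) : M q a = some (q'.1, .move .right) →
      Tile M S [.hd q a, .sym b] [.sym a, .hd q' b]
  | right' (q q' : S) (a : Γ) : M q a = some (q'.1, .move .right) →
      Tile M S [.hd q a, .rt] [.sym a, .hd q' default, .rt]
  | left (q q' : S) (a b : Γ) : M q a = some (q'.1, .move .left) →
      Tile M S [.sym b, .hd q a] [.hd q' b, .sym a]
  | left' (q q' : S) (a : Γ) : M q a = some (q'.1, .move .left) →
      Tile M S [.lt, .hd q a] [.lt, .hd q' default, .sym a]
  | halt (q : S) (a : Γ) : M q a = none → Tile M S [.hd q a] [.ht]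
  | erase (x) : Tile M S [.ht, x] [.ht]

section
variable {Γ Λ : Type} [Inhabited Γ] [Inhabited Λ] (M : TM0.Machine Γ Λ) (S : Set Λ)

def TI : Type := {p : List (TQ Γ S) × List (TQ Γ S) // Tile M S p.1 p.2}

theorem TI.finite [Finite Γ] (hS : S.Finite) : Finite (TI M S) := by
  have := hS.to_subtype
  have := TQ.finite Γ S
  have h := (List.finite_length_le (TQ Γ S) 3).prod (List.finite_length_le (TQ Γ S) 3)
  have h2 : {p : List (TQ Γ S) × List (TQ Γ S) | Tile M S p.1 p.2}.Finite := by
    refine h.subset ?_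
    rintro ⟨v, u⟩ hh
    change Tile M S v u at hh
    cases hh <;> simp
  exact h2.to_subtype

def tv (i : TI M S) := i.1.1
def tu (i : TI M S) := i.1.2

def canon (q : S) (a : Γ) (l r : List Γ) : List (TQ Γ S) :=
  .hd q a :: (r.map .sym ++ .rt :: .lt :: (l.reverse.map .sym))

def tcfg (q : S) (a : Γ) (l r : List Γ) : TM0.Cfg Γ Λ := ⟨q, ⟨a, ListBlank.mk l, ListBlank.mk r⟩⟩

abbrev QR := Relation.ReflTransGen (QStep (tv M S) (tu M S))

variable {M S}

theorem QR.tile {v u : List (TQ Γ S)} (h : Tile M S v u) (w) : QR M S (v ++ w) (w ++ u) :=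
  .single ⟨⟨(v, u), h⟩, w, rfl, rfl⟩

theorem QR.rot (x y : List (TQ Γ S)) : QR M S (x ++ y) (y ++ x) := by
  induction x generalizing y with
  | nil => simpa using Relation.ReflTransGen.refl
  | cons a x ih =>
    have h1 := QR.tile (Tile.copy (M := M) a) (x ++ y)
    refine h1.trans ?_
    have := ih (y ++ [a])
    simpa using this

theorem QR.tile' {v u : List (TQ Γ S)} (h : Tile M S v u) (x y) :
    QR M S (x ++ v ++ y) (x ++ u ++ y) := by
  have h1 := QR.rot (M := M) x (v ++ y)
  have h2 := QR.tile h (y ++ x)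
  have h3 := QR.rot (M := M) (y ++ x) u
  have h4 := QR.rot (M := M) (u ++ y) x
  simp only [List.append_assoc] at *
  exact ((h1.trans h2).trans h3).trans h4

/-- forward simulation -/
theorem fwd_step (ss : TM0.Supports M S) (q : S) (a : Γ) (l r : List Γ) (c' : TM0.Cfg Γ Λ)
    (h : c' ∈ TM0.step M (tcfg S q a l r)) :
    ∃ q' a' l' r', c' = tcfg S q' a' l' r' ∧ QR M S (canon S q a l r) (canon S q' a' l' r') := by
  obtain ⟨⟨q', s⟩, h1, rfl⟩ := Option.map_eq_some_iff.1 h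
  have hq : q' ∈ S := ss.2 h1 q.2
  change M q a = some (q', s) at h1
  obtain d | b := s
  · cases d
    · cases l with
      | nil =>
        refine ⟨⟨q', hq⟩, default, [], a :: r, rfl, ?_⟩
        have ht := Tile.left' (M := M) q ⟨q', hq⟩ a h1
        have h1 := QR.tile' ht (r.map .sym ++ [.rt]) []
        have h0 := QR.rot (M := M) [.hd q a] (r.map .sym ++ [.rt] ++ [.lt])
        have h2 := QR.rot (M := M) (r.map .sym ++ [.rt] ++ [.lt]) [.hd ⟨q', hq⟩ default, .sym a]
        simp only [canon] 
        simp at h0 h1 h2 ⊢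
        exact (h0.trans h1).trans h2
      | cons b l =>
        refine ⟨⟨q', hq⟩, b, l, a :: r, rfl, ?_⟩
        have ht := Tile.left (M := M) q ⟨q', hq⟩ a b h1
        have h1 := QR.tile' ht (r.map .sym ++ .rt :: .lt :: (l.reverse.map .sym)) []
        have h0 := QR.rot (M := M) [.hd q a] (r.map .sym ++ .rt :: .lt :: (l.reverse.map .sym ++ [.sym b]))
        have h2 := QR.rot (M := M) (r.map .sym ++ .rt :: .lt :: (l.reverse.map .sym)) [.hd ⟨q', hq⟩ b, .sym a]
        simp only [canon] 
        simp at h0 h1 h2 ⊢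
        exact (h0.trans h1).trans h2
    · cases r with
      | nil =>
        refine ⟨⟨q', hq⟩, default, a :: l, [], rfl, ?_⟩
        have ht := Tile.right' (M := M) q ⟨q', hq⟩ a h1
        have h1 := QR.tile' ht [] (.lt :: (l.reverse.map .sym))
        have h2 := QR.rot (M := M) [.sym a] (.hd ⟨q', hq⟩ default :: .rt :: .lt :: (l.reverse.map .sym))
        simp only [canon] 
        simp at h1 h2 ⊢
        exact h1.trans h2
      | cons b r =>
        refine ⟨⟨q', hq⟩, b, a :: l, r, rfl, ?_⟩
        have ht := Tile.right (M := M) q ⟨q', hq⟩ a b h1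
        have h1 := QR.tile' ht [] (r.map .sym ++ .rt :: .lt :: (l.reverse.map .sym))
        have h2 := QR.rot (M := M) [.sym a] (.hd ⟨q', hq⟩ b :: (r.map .sym ++ .rt :: .lt :: (l.reverse.map .sym)))
        simp only [canon] 
        simp at h1 h2 ⊢
        exact h1.trans h2
  · refine ⟨⟨q', hq⟩, b, l, r, rfl, ?_⟩
    have ht := Tile.write (M := M) q ⟨q', hq⟩ a b h1
    have h1 := QR.tile' ht [] (r.map .sym ++ .rt :: .lt :: (l.reverse.map .sym))
    simpa [canon] using h1

theorem erase_all (w : List (TQ Γ S)) : QR M S (.ht :: w) [.ht] := by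
  induction w with
  | nil => exact .refl
  | cons a w ih =>
    have h1 := QR.tile' (Tile.erase (M := M) a) [] w
    exact Relation.ReflTransGen.trans (by simpa using h1) ih

theorem fwd (ss : TM0.Supports M S) (q : S) (a : Γ) (l r : List Γ)
    (h : (StateTransition.eval (TM0.step M) (tcfg S q a l r)).Dom) :
    QAcc (tv M S) (tu M S) (canon S q a l r) := by
  refine ⟨⟨([.ht], [.ht]), Tile.copy _⟩, ?_⟩
  change QR M S _ [.ht]
  obtain ⟨c, hc⟩ := Part.dom_iff_mem.1 h
  rw [StateTransition.mem_eval] at hc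
  obtain ⟨hr, hn⟩ := hc
  have : ∃ q' a' l' r', c = tcfg S q' a' l' r' ∧ QR M S (canon S q a l r) (canon S q' a' l' r') := by
    clear hn h
    induction hr with
    | refl => exact ⟨q, a, l, r, rfl, .refl⟩
    | tail _ hs ih =>
      obtain ⟨q1, a1, l1, r1, rfl, h1⟩ := ih
      obtain ⟨q2, a2, l2, r2, rfl, h2⟩ := fwd_step ss _ _ _ _ _ hs
      exact ⟨q2, a2, l2, r2, rfl, h1.trans h2⟩
  obtain ⟨q1, a1, l1, r1, rfl, h1⟩ := this
  refine h1.trans ?_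
  have hm : M q1 a1 = none := by
    have := hn
    simpa [TM0.step, tcfg] using hn
  have h2 := QR.tile' (Tile.halt (M := M) q1 a1 hm) [] (r1.map .sym ++ .rt :: .lt :: (l1.reverse.map .sym))
  exact Relation.ReflTransGen.trans (by simpa [canon] using h2) (erase_all _)

def isHd : TQ Γ S → Prop
  | .hd _ _ => True
  | _ => False

theorem rot_uniq {x y : TQ Γ S} {s t : List (TQ Γ S)} (h : (x :: s) ~r (y :: t))
    (hx : isHd x) (ht : ∀ z ∈ t, ¬ isHd z) : x = y ∧ s = t := by
  obtain ⟨n, hn, h⟩ := List.isRotated_iff_mod.1 h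
  rw [List.rotate_eq_drop_append_take hn] at h
  have h0 := List.take_append_drop n (x :: s)
  revert h0 h
  generalize (x :: s).take n = l1
  generalize (x :: s).drop n = l2
  intro h h0
  cases l1 with
  | nil => simp_all
  | cons z l1 =>
    cases l2 with
    | nil => simp_all
    | cons z' l2 =>
      simp at h h0
      exfalso
      apply ht z _ (h0.1 ▸ hx)
      rw [← h.2]
      simp

theorem canon_tail_nohd (l r : List Γ) :
    ∀ z ∈ (r.map .sym ++ .rt :: .lt :: (l.reverse.map .sym) : List (TQ Γ S)), ¬ isHd z := by
  intro z hz
  simp at hz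
  rcases hz with ⟨a, _, rfl⟩ | rfl | rfl | ⟨a, _, rfl⟩ <;> simp [isHd]

/-- backward simulation -/
theorem bwd_step (q : S) (a : Γ) (l r : List Γ) (v u w : List (TQ Γ S)) (h : Tile M S v u)
    (hr : (v ++ w) ~r canon S q a l r) :
    ((w ++ u) ~r canon S q a l r) ∨ TM0.step M (tcfg S q a l r) = none ∨
    ∃ q' a' l' r', tcfg S q' a' l' r' ∈ TM0.step M (tcfg S q a l r) ∧
      (w ++ u) ~r canon S q' a' l' r' := by
  have key : ∀ (q1 : S) a1 s, (.hd q1 a1 :: s) ~r canon S q a l r →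
      q1 = q ∧ a1 = a ∧ s = (r.map .sym ++ .rt :: .lt :: (l.reverse.map .sym)) := by
    intro q1 a1 s hs
    obtain ⟨h1, h2⟩ := rot_uniq hs trivial (canon_tail_nohd l r)
    cases h1
    exact ⟨rfl, rfl, h2⟩
  cases h with
  | copy x =>
    left
    exact (List.isRotated_append (l := w) (l' := [x])).trans hr
  | write q1 q' a1 b hm =>
    right; right
    obtain ⟨rfl, rfl, rfl⟩ := key _ _ _ hr
    refine ⟨q', b, l, r, ?_, ?_⟩
    · simp [TM0.step, tcfg, hm]
    · exact List.isRotated_append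
  | right q1 q' a1 b hm =>
    right; right
    obtain ⟨rfl, rfl, hw⟩ := key _ _ _ hr
    cases r with
    | nil => simp at hw
    | cons b' r =>
      simp at hw
      obtain ⟨rfl, rfl⟩ := hw
      refine ⟨q', b, a1 :: l, r, ?_, ?_⟩
      · simp [TM0.step, tcfg, hm, Tape.move]
      · have := List.isRotated_append (l := ((r.map .sym ++ .rt :: .lt :: (l.reverse.map .sym)) ++ [.sym a1] : List (TQ Γ S))) (l' := ([.hd q' b] : List (TQ Γ S)))
        simpa [canon] using this
  | right' q1 q' a1 hm =>
    right; right
    obtain ⟨rfl, rfl, hw⟩ := key _ _ _ hr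
    cases r with
    | cons b' r => simp at hw
    | nil =>
      simp at hw
      obtain rfl := hw
      refine ⟨q', default, a1 :: l, [], ?_, ?_⟩
      · simp [TM0.step, tcfg, hm, Tape.move]
      · have := List.isRotated_append (l := ((.lt :: (l.reverse.map .sym)) ++ [.sym a1] : List (TQ Γ S))) (l' := ([.hd q' default, .rt] : List (TQ Γ S)))
        simpa [canon] using this
  | left q1 q' a1 b hm =>
    right; right
    have hr' : (.hd q1 a1 :: (w ++ [.sym b])) ~r canon S q a l r := by
      refine List.IsRotated.trans ?_ hr
      exact List.isRotated_append (l := .hd q1 a1 :: w) (l' := [.sym b])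
    obtain ⟨rfl, rfl, hw⟩ := key _ _ _ hr'
    cases l with
    | nil =>
      have := congrArg List.getLast? hw
      simp [List.getLast?_append] at this
    | cons b' l =>
      have hw' : w ++ [.sym b] = (r.map .sym ++ .rt :: .lt :: (l.reverse.map .sym)) ++ [.sym b'] := by
        simpa using hw
      obtain ⟨rfl, h2⟩ := List.append_inj' hw' rfl
      simp at h2
      subst h2
      refine ⟨q', b, l, a1 :: r, ?_, ?_⟩
      · simp [TM0.step, tcfg, hm, Tape.move]
      · have := List.isRotated_append (l := ((r.map .sym ++ .rt :: .lt :: (l.reverse.map .sym)) : List (TQ Γ S))) (l' := ([.hd q' b, .sym a1] : List (TQ Γ S)))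
        simpa [canon] using this
  | left' q1 q' a1 hm =>
    right; right
    have hr' : (.hd q1 a1 :: (w ++ [.lt])) ~r canon S q a l r := by
      refine List.IsRotated.trans ?_ hr
      exact List.isRotated_append (l := .hd q1 a1 :: w) (l' := [.lt])
    obtain ⟨rfl, rfl, hw⟩ := key _ _ _ hr'
    cases l with
    | cons b l =>
      have hw' : w ++ [.lt] = (r.map .sym ++ .rt :: .lt :: (l.reverse.map .sym)) ++ [.sym b] := by
        simpa using hw
      have h2 := (List.append_inj' hw' rfl).2
      simp at h2
    | nil =>
      have hw' : w ++ [.lt] = (r.map .sym ++ [.rt]) ++ [.lt] := by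
        simpa using hw
      obtain ⟨rfl, h2⟩ := List.append_inj' hw' rfl
      refine ⟨q', default, [], a1 :: r, ?_, ?_⟩
      · simp [TM0.step, tcfg, hm, Tape.move]
      · have := List.isRotated_append (l := ((r.map .sym ++ [.rt, .lt]) : List (TQ Γ S))) (l' := ([.hd q' default, .sym a1] : List (TQ Γ S)))
        simpa [canon] using this
  | halt q1 a1 hm =>
    right; left
    obtain ⟨rfl, rfl, rfl⟩ := key _ _ _ hr
    simp [TM0.step, tcfg, hm]
  | erase x =>
    exfalso
    have : (TQ.ht : TQ Γ S) ∈ canon S q a l r := hr.mem_iff.1 (by simp)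
    simp [canon] at this

theorem bwd (q : S) (a : Γ) (l r : List Γ) (h : QAcc (tv M S) (tu M S) (canon S q a l r)) :
    (StateTransition.eval (TM0.step M) (tcfg S q a l r)).Dom := by
  obtain ⟨i, h⟩ := h
  have inv : ∀ w, QR M S (canon S q a l r) w →
      (StateTransition.eval (TM0.step M) (tcfg S q a l r)).Dom ∨
      ∃ q' a' l' r', StateTransition.Reaches (TM0.step M) (tcfg S q a l r) (tcfg S q' a' l' r') ∧
        w ~r canon S q' a' l' r' := by
    intro w hw
    induction hw with
    | refl => exact .inr ⟨q, a, l, r, .refl, .refl _⟩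
    | tail _ hs ih =>
      rcases ih with ih | ⟨q1, a1, l1, r1, h1, h2⟩
      · exact .inl ih
      obtain ⟨j, w', rfl, rfl⟩ := hs
      rcases bwd_step _ _ _ _ _ _ _ j.2 h2 with h3 | h3 | ⟨q2, a2, l2, r2, h3, h4⟩
      · exact .inr ⟨_, _, _, _, h1, h3⟩
      · exact .inl (Part.dom_iff_mem.2 ⟨_, StateTransition.mem_eval.2 ⟨h1, h3⟩⟩)
      · exact .inr ⟨_, _, _, _, h1.tail h3, h4⟩
  rcases inv _ h with h | ⟨q', a', l', r', _, h2⟩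
  · exact h
  · exfalso
    have hl := h2.perm.length_eq
    obtain ⟨⟨v, u⟩, ht⟩ := i
    simp only [tv, canon] at hl
    cases ht <;> simp at hl <;> omega
end

theorem part2 {Γ Λ : Type} [Inhabited Γ] [Inhabited Λ] [Finite Γ]
    (M : TM0.Machine Γ Λ) (S : Set Λ) (X B C : Γ) (hS : S.Finite) (ss : TM0.Supports M S)
    (hn : ¬ ComputablePred fun k : ℕ => (TM0.eval M (X :: B :: List.replicate k C)).Dom) :
    ∃ (Q I : Type) (_ : Finite Q) (_ : Finite I) (v u : I → List Q) (pre post : List Q) (c : Q),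
      (∀ i, v i ≠ []) ∧ (∀ i, u i ≠ []) ∧ pre ≠ [] ∧ post ≠ [] ∧
      ¬ ComputablePred fun k : ℕ => QAcc v u (pre ++ List.replicate k c ++ post) := by
  have := hS.to_subtype
  refine ⟨TQ Γ S, TI M S, TQ.finite _ _, TI.finite M S hS, tv M S, tu M S,
    [.hd ⟨default, ss.1⟩ X, .sym B], [.rt, .lt], .sym C, ?_, ?_, by simp, by simp, ?_⟩
  · rintro ⟨⟨v, u⟩, h⟩
    cases h <;> simp [tv]
  · rintro ⟨⟨v, u⟩, h⟩
    cases h <;> simp [tu]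
  · convert hn using 3 with k
    have h1 : [.hd ⟨default, ss.1⟩ X, .sym B] ++ List.replicate k (.sym C) ++ [.rt, .lt] =
      canon S ⟨default, ss.1⟩ X [] (B :: List.replicate k C) := by
      simp [canon]
    rw [h1]
    exact ⟨bwd _ _ _ _, fwd ss ⟨default, ss.1⟩ X [] (B :: List.replicate k C)⟩

end tmq


section stick
variable {Q I : Type}

inductive Tg (I : Type)
  | nil : Tg I
  | inp : Tg I
  | post : Tg I
  | tile : I → Tg I

theorem Tg.finite (I : Type) [Finite I] : Finite (Tg I) := by
  refine Finite.of_injective (fun x : Tg I => (match x with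
    | .tile a => .inl a
    | .nil => .inr 0
    | .inp => .inr 1
    | .post => .inr 2 : I ⊕ Fin 3)) ?_
  intro a b h
  cases a <;> cases b <;> simp_all

inductive SA (I : Type)
  | dead : SA I
  | ini : SA I
  | inp : SA I
  | run : ZMod 3 → Option I → SA I

theorem SA.finite (I : Type) [Finite I] : Finite (SA I) := by
  refine Finite.of_injective (fun x : SA I => (match x with
    | .run n l => .inl (n, l)
    | .dead => .inr 0
    | .ini => .inr 1
    | .inp => .inr 2 : (ZMod 3 × Option I) ⊕ Fin 3)) ?_
  intro a b h
  cases a <;> cases b <;> simp_all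

def dA : SA I → Tg I → SA I
  | s, .nil => s
  | .ini, .inp => .inp
  | .inp, .inp => .inp
  | .ini, .post => .run 0 none
  | .inp, .post => .run 0 none
  | .run n _, .tile i => .run (n + 1) (some i)
  | _, _ => .dead

def dB : ZMod 3 × Option I → Tg I → ZMod 3 × Option I
  | s, .tile i => (s.1 + 1, some i)
  | s, _ => s

abbrev SW (Q I : Type) := Q × Tg I

def dE (s : SA I × (ZMod 3 × Option I)) (p : Option (SW Q I) × Option (SW Q I)) :
    SA I × (ZMod 3 × Option I) :=
  (match p.1 with
    | none => .dead
    | some a => dA s.1 a.2,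
   match p.2 with
    | none => s.2
    | some a => dB s.2 a.2)

open Classical in
noncomputable def outS : SA I × (ZMod 3 × Option I) → Option (Option Bool)
  | (.dead, _) => some none
  | (.ini, (n, l)) => if n = 0 ∧ l = none then none else some none
  | (.inp, (n, l)) => if n = 0 ∧ l = none then some (some true) else some none
  | (.run n l, (n', l')) => if (n = n' ∧ l = l') ∨ n' = n + 1 then none else some none

noncomputable def obsA (w : List (Option (SW Q I) × Option (SW Q I))) : Option (Option Bool) :=
  outS (w.foldl dE (.ini, (0, none)))

theorem obsA_regular [Finite I] : ObserverRegular (obsA (Q := Q) (I := I)) := by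
  intro o
  have := SA.finite I
  have : Finite (SA I × (ZMod 3 × Option I)) := inferInstance
  have := Fintype.ofFinite (SA I × (ZMod 3 × Option I))
  refine ⟨SA I × (ZMod 3 × Option I), this, ⟨dE, (.ini, (0, none)), {s | outS s = o}⟩, ?_⟩
  ext w
  rfl

def fA (s : SA I) (w : List (SW Q I)) : SA I := w.foldl (fun s a => dA s a.2) s
def fB (s : ZMod 3 × Option I) (w : List (SW Q I)) : ZMod 3 × Option I :=
  w.foldl (fun s a => dB s a.2) s

theorem enc_nil {V : Type} : encodeMolecule (([], []) : Molecule V) = [] := rfl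
theorem enc_cc {V : Type} (a b : V) (x y : List V) :
    encodeMolecule (a :: x, b :: y) = (some a, some b) :: encodeMolecule (x, y) := by
  simp [encodeMolecule, List.range_succ_eq_map, Nat.succ_max_succ]
theorem enc_cn {V : Type} (a : V) (x : List V) :
    encodeMolecule (a :: x, []) = (some a, none) :: encodeMolecule (x, []) := by
  simp [encodeMolecule, List.range_succ_eq_map]
theorem enc_nc {V : Type} (b : V) (y : List V) :
    encodeMolecule ([], b :: y) = (none, some b) :: encodeMolecule ([], y) := by
  simp [encodeMolecule, List.range_succ_eq_map]

theorem fold_le (x y : List (SW Q I)) (h : y.length ≤ x.length) (s t) :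
    (encodeMolecule (x, y)).foldl dE (s, t) = (fA s x, fB t y) := by
  induction x generalizing y s t with
  | nil => 
    cases y with
    | nil => rfl
    | cons b y => simp at h
  | cons a x ih =>
    cases y with
    | nil => rw [enc_cn, List.foldl_cons, dE, ih _ (by simp)]; rfl
    | cons b y => rw [enc_cc, List.foldl_cons, dE, ih _ (by simpa using h)]; rfl

theorem dA_dead (t : Tg I) : dA .dead t = .dead := by cases t <;> rfl

theorem fold_dead (z : List (Option (SW Q I) × Option (SW Q I))) (t) :
    (z.foldl dE (.dead, t)).1 = .dead := by
  induction z generalizing t with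
  | nil => rfl
  | cons p z ih =>
    rw [List.foldl_cons, dE]
    rcases p with ⟨_ | a, b⟩
    · exact ih _
    · simp only [dA_dead]; exact ih _

theorem fold_gt (x y : List (SW Q I)) (h : x.length < y.length) (s t) :
    ((encodeMolecule (x, y)).foldl dE (s, t)).1 = .dead := by
  induction x generalizing y s t with
  | nil => 
    cases y with
    | nil => simp at h
    | cons b y => rw [enc_nc, List.foldl_cons, dE]; exact fold_dead _ _
  | cons a x ih =>
    cases y with
    | nil => simp at h
    | cons b y => rw [enc_cc, List.foldl_cons, dE]; exact ih _ (by simpa using h) _ _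

theorem obs_le (m : Molecule (SW Q I)) (h : m.2.length ≤ m.1.length) :
    obsA (encodeMolecule m) = outS (fA .ini m.1, fB (0, none) m.2) := by
  rw [obsA, ← fold_le _ _ h]

theorem obs_gt (m : Molecule (SW Q I)) (h : m.1.length < m.2.length) :
    obsA (encodeMolecule m) = some none := by
  have := fold_gt m.1 m.2 h .ini (0, none)
  rw [obsA]
  revert this
  generalize List.foldl dE _ _ = z
  rintro h
  rcases z with ⟨a, b⟩
  cases h
  rfl

def nilW (w : List Q) : List (SW Q I) := w.map (·, .nil)
def tagW (t : Tg I) : List Q → List (SW Q I)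
  | [] => []
  | a :: w => (a, t) :: nilW w

@[simp] theorem nilW_fst (w : List Q) : (nilW w : List (SW Q I)).map Prod.fst = w := by
  simp [nilW, Function.comp_def]
@[simp] theorem tagW_fst (t : Tg I) (w : List Q) : (tagW t w).map Prod.fst = w := by
  cases w <;> simp [tagW]
@[simp] theorem fA_nilW (s : SA I) (w : List Q) : fA s (nilW w) = s := by
  induction w with
  | nil => rfl
  | cons a w ih => 
    change fA (dA s .nil) (nilW w) = s
    cases s <;> exact ih
@[simp] theorem fB_nilW (s : ZMod 3 × Option I) (w : List Q) : fB s (nilW w) = s := by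
  induction w with
  | nil => rfl
  | cons a w ih => exact ih
theorem fA_tagW (s : SA I) (t) (w : List Q) (h : w ≠ []) : fA s (tagW t w) = dA s t := by
  cases w with
  | nil => simp at h
  | cons a w => exact fA_nilW _ _
theorem fB_tagW (s : ZMod 3 × Option I) (t) (w : List Q) (h : w ≠ []) :
    fB s (tagW t w) = dB s t := by
  cases w with
  | nil => simp at h
  | cons a w => exact fB_nilW _ _
theorem fA_append (s : SA I) (x y : List (SW Q I)) : fA s (x ++ y) = fA (fA s x) y :=
  List.foldl_append
theorem fB_append (s : ZMod 3 × Option I) (x y : List (SW Q I)) :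
    fB s (x ++ y) = fB (fB s x) y :=
  List.foldl_append

@[simp] theorem fA_nil (s : SA I) : fA s ([] : List (SW Q I)) = s := rfl
@[simp] theorem fB_nil (s : ZMod 3 × Option I) : fB s ([] : List (SW Q I)) = s := rfl

theorem forall₂_fst (x y : List (SW Q I)) :
    List.Forall₂ (fun a b : SW Q I => a.1 = b.1) x y ↔ x.map Prod.fst = y.map Prod.fst := by
  induction x generalizing y with
  | nil => cases y <;> simp
  | cons a x ih => cases y <;> simp [ih]

theorem ws_le (m : Molecule (SW Q I)) (h : m.2.length ≤ m.1.length)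
    (hw : IsWellStarted (fun a b : SW Q I => a.1 = b.1) m) :
    ∃ w, m.1.map Prod.fst = m.2.map Prod.fst ++ w := by
  obtain ⟨x, y, z, h1, rfl | rfl⟩ := hw
  · rw [forall₂_fst] at h1
    exact ⟨z.map Prod.fst, by simp [h1]⟩
  · rw [forall₂_fst] at h1
    have := congrArg List.length h1
    simp at this h
    have : z = [] := by
      apply List.length_eq_zero_iff.1; omega
    subst this
    exact ⟨[], by simp [h1]⟩

theorem ws_of (m : Molecule (SW Q I)) (w) (h : m.1.map Prod.fst = m.2.map Prod.fst ++ w) :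
    IsWellStarted (fun a b : SW Q I => a.1 = b.1) m := by
  obtain ⟨x, z, h1, h2, h3⟩ := List.map_eq_append_iff.1 h
  refine ⟨x, m.2, z, ?_, .inl ?_⟩
  · rw [forall₂_fst]; exact h2
  · rw [← h1]

inductive Run {V : Type} (γ : StickerSystem V)
    (A : List (Option V × Option V) → Option (Option Bool)) :
    Molecule V → List (Option Bool) → Prop
  | ax (m) : m ∈ γ.axioms → Run γ A m (A (encodeMolecule m)).toList
  | step (m m' x) : Run γ A m x → γ.Step m m' →
      Run γ A m' (x ++ (A (encodeMolecule m')).toList)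

theorem run_of {V : Type} (γ : StickerSystem V)
    (A : List (Option V × Option V) → Option (Option Bool)) (ws : List (Molecule V))
    (m : Molecule V)
    (h1 : ∃ a ∈ γ.axioms, ws.head? = some a) (h2 : List.Chain' γ.Step ws)
    (h3 : ws.getLast? = some m) :
    Run γ A m (ws.map fun w => (A (encodeMolecule w)).toList).flatten := by
  induction ws using List.reverseRecOn generalizing m with
  | nil => simp at h3
  | append_singleton ws m' ih =>
    simp at h3
    subst h3
    rcases List.eq_nil_or_concat' ws with rfl | ⟨ws', m1, rfl⟩
    · obtain ⟨a, ha, hb⟩ := h1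
      simp at hb
      subst hb
      simpa using Run.ax (A := A) _ ha
    · rw [List.map_append, List.flatten_append]
      have h2' := List.isChain_append.1 h2
      have := ih m1 (by
        obtain ⟨a, ha, hb⟩ := h1
        exact ⟨a, ha, by cases ws' <;> simpa using hb⟩) h2'.1 (by simp)
      have := Run.step _ m' _ this (h2'.2.2 _ (by simp) _ (by simp))
      simpa using this

theorem of_run {V : Type} (γ : StickerSystem V)
    (A : List (Option V × Option V) → Option (Option Bool)) 
    (m : Molecule V) (x) (h : Run γ A m x) : ∃ ws : List (Molecule V),
    (∃ a ∈ γ.axioms, ws.head? = some a) ∧ List.Chain' γ.Step ws ∧ 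
    ws.getLast? = some m ∧ x = (ws.map fun w => (A (encodeMolecule w)).toList).flatten := by
  induction h with
  | ax m hm => exact ⟨[m], ⟨m, hm, rfl⟩, List.isChain_singleton _, rfl, by simp⟩
  | step m m' x _ hs ih =>
    obtain ⟨ws, ⟨a, ha, hb⟩, h2, h3, h4⟩ := ih
    refine ⟨ws ++ [m'], ⟨a, ha, by simp [hb]⟩, ?_, by simp, by simp [h4]⟩
    refine List.isChain_append.2 ⟨h2, List.isChain_singleton _, ?_⟩
    intro y hy z hz
    rw [h3] at hy
    simp at hy hz
    subst hy hz
    exact hs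

theorem mem_iff_run {V : Type} (γ : StickerSystem V)
    (A : List (Option V × Option V) → Option (Option Bool)) (x) :
    x ∈ obsStickerLang γ A ↔ ∃ m, Run γ A m x ∧ IsCompleteMolecule γ.compl m := by
  constructor
  · rintro ⟨ws, ⟨h1, h2, m, h3, h4⟩, rfl⟩
    exact ⟨m, run_of γ A ws m h1 h2 h3, h4⟩
  · rintro ⟨m, h, h4⟩
    obtain ⟨ws, h1, h2, h3, h5⟩ := of_run γ A m x h
    exact ⟨ws, ⟨h1, h2, m, h3, h4⟩, h5⟩

variable (v u : I → List Q) (pre post : List Q) (c : Q)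

def theSys : StickerSystem (SW Q I) where
  compl a b := a.1 = b.1
  axioms := {(nilW pre, [])}
  dominoes := {(tagW .inp [c], []), (tagW .post post, [])} ∪
    (Set.range (fun i => (tagW (.tile i) (u i), [])) ∪
     Set.range (fun i => ([], tagW (.tile i) (v i))))

theorem theSys_simple [Finite I] : (theSys v u pre post c).IsSimpleRegular := by
  refine ⟨fun a b h => h.symm, Set.finite_singleton _, ?_, ?_, ?_⟩
  · rintro m rfl
    exact ws_of _ pre (by simp)
  · exact (Set.toFinite _).union ((Set.finite_range _).union (Set.finite_range _))
  · rintro m ((rfl | rfl) | (⟨i, rfl⟩ | ⟨i, rfl⟩)) <;> simp [IsSingleStrand]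

abbrev start (j : ℕ) := pre ++ List.replicate j c ++ post

abbrev RQ := Relation.ReflTransGen (QStep v u)

def SInv (m : Molecule (SW Q I)) (j : ℕ) : Prop :=
  (fA .ini m.1 = .ini ∧ fB (0, none) m.2 = (0, none) ∧ j = 0 ∧ m.1.map Prod.fst = pre ∧ m.2 = []) ∨
  (fA .ini m.1 = .inp ∧ fB (0, none) m.2 = (0, none) ∧
    m.1.map Prod.fst = pre ++ List.replicate j c ∧ m.2 = []) ∨
  (∃ n l w, fA .ini m.1 = .run n l ∧ fB (0, none) m.2 = (n, l) ∧
    m.1.map Prod.fst = m.2.map Prod.fst ++ w ∧ w ≠ [] ∧ RQ v u (start pre post c j) w) ∨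
  (∃ n l i w, fA .ini m.1 = .run n l ∧ fB (0, none) m.2 = (n + 1, some i) ∧
    m.1.map Prod.fst = m.2.map Prod.fst ++ w ∧ RQ v u (start pre post c j) (v i ++ w))

theorem z3a (n : ZMod 3) : n + 1 ≠ n := by revert n; decide
theorem z3b (n : ZMod 3) : n ≠ n + 1 + 1 := by revert n; decide

variable {v u pre post c}

theorem inv_step (hv : ∀ i, v i ≠ []) (hu : ∀ i, u i ≠ []) (hpost : post ≠ [])
    (m m' : Molecule (SW Q I)) (j : ℕ) (h : SInv v u pre post c m j)
    (hs : (theSys v u pre post c).Step m m') (ho : obsA (encodeMolecule m') ≠ some none) :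
    ∃ k, (obsA (encodeMolecule m')).toList = List.replicate k (some true) ∧
      SInv v u pre post c m' (j + k) := by
  obtain ⟨d, hd, rfl, hws⟩ := hs
  have hle : (m.2 ++ d.2).length ≤ (m.1 ++ d.1).length := by
    by_contra hlt
    exact ho (obs_gt _ (by simpa using hlt))
  obtain ⟨z, hz⟩ := ws_le _ hle hws
  rw [obs_le _ hle] at ho ⊢
  simp only [fA_append, fB_append] at ho ⊢
  rcases hd with (rfl | rfl) | (⟨i, rfl⟩ | ⟨i, rfl⟩)
  -- input letter
  · rw [fA_tagW _ _ _ (by simp)] at ho ⊢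
    rcases h with ⟨h1, h2, rfl, h4, h5⟩ | ⟨h1, h2, h4, h5⟩ | ⟨n, l, w, h1, h2, h4, h5, h6⟩ |
      ⟨n, l, i, w, h1, h2, h4, h6⟩ 
    · refine ⟨1, ?_, .inr (.inl ?_)⟩
      · simp [h1, h2, dA, outS]
      · simp [fA_append, fA_tagW, h1, h2, h4, h5, dA]
    · refine ⟨1, ?_, .inr (.inl ?_)⟩
      · simp [h1, h2, dA, outS]
      · simp [fA_append, fA_tagW, h1, h2, h4, h5, dA, List.replicate_succ']
    · simp [h1, dA, outS] at ho
    · simp [h1, dA, outS] at ho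
  -- post
  · rw [fA_tagW _ _ _ hpost] at ho ⊢
    rcases h with ⟨h1, h2, rfl, h4, h5⟩ | ⟨h1, h2, h4, h5⟩ | ⟨n, l, w, h1, h2, h4, h5, h6⟩ |
      ⟨n, l, i, w, h1, h2, h4, h6⟩ 
    · refine ⟨0, ?_, .inr (.inr (.inl ⟨0, none, pre ++ post, ?_⟩))⟩
      · simp [h1, h2, dA, outS]
      · simp [fA_append, fA_tagW, hpost, h1, h2, h4, h5, dA]
        exact .refl
    · refine ⟨0, ?_, .inr (.inr (.inl ⟨0, none, start pre post c j, ?_⟩))⟩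
      · simp [h1, h2, dA, outS]
      · simp [fA_append, fA_tagW, hpost, h1, h2, h4, h5, dA]
        exact .refl
    · simp [h1, dA, outS] at ho
    · simp [h1, dA, outS] at ho
  -- push
  · rw [fA_tagW _ _ _ (hu i)] at ho ⊢
    rcases h with ⟨h1, h2, rfl, h4, h5⟩ | ⟨h1, h2, h4, h5⟩ | ⟨n, l, w, h1, h2, h4, h5, h6⟩ |
      ⟨n, l, i', w, h1, h2, h4, h6⟩ 
    · simp [h1, dA, outS] at ho
    · simp [h1, dA, outS] at ho
    · exfalso
      apply ho
      simp [h1, h2, dA, outS, z3a, z3b]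
    · have hi : i = i' := by
        by_contra hne
        apply ho
        simp [h1, h2, dA, outS, hne, (z3a _).symm]
      subst hi
      refine ⟨0, ?_, .inr (.inr (.inl ⟨n + 1, some i, w ++ u i, ?_⟩))⟩
      · simp [h1, h2, dA, outS]
      · simp only [List.append_nil]
        refine ⟨?_, h2, ?_, ?_, h6.tail ⟨i, w, rfl, rfl⟩⟩
        · simp [fA_append, fA_tagW, hu, h1, dA]
        · simp [h4]
        · simp [hu]
  -- pop
  · rw [fB_tagW _ _ _ (hv i)] at ho ⊢
    rcases h with ⟨h1, h2, rfl, h4, h5⟩ | ⟨h1, h2, h4, h5⟩ | ⟨n, l, w, h1, h2, h4, h5, h6⟩ |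
      ⟨n, l, i', w, h1, h2, h4, h6⟩ 
    · simp [h1, h2, dB, outS] at ho
    · simp [h1, h2, dB, outS] at ho
    · refine ⟨0, ?_, .inr (.inr (.inr ⟨n, l, i, z, ?_⟩))⟩
      · simp [h1, h2, dB, outS]
      · refine ⟨by simpa using h1, ?_, hz, ?_⟩
        · simp [fB_append, fB_tagW, hv, h2, dB]
        · simp [h4] at hz
          rw [← hz]; exact h6
    · exfalso
      apply ho
      simp [h1, h2, dB, outS, z3a, z3b]

theorem sound (hv : ∀ i, v i ≠ []) (hu : ∀ i, u i ≠ []) (hpost : post ≠ [])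
    (m : Molecule (SW Q I)) (x) (h : Run (theSys v u pre post c) obsA m x)
    (hx : none ∉ x) : ∃ j, x = List.replicate j (some true) ∧ SInv v u pre post c m j := by
  induction h with
  | ax m hm =>
    obtain rfl := hm
    refine ⟨0, ?_, .inl ?_⟩
    · rw [obs_le _ (by simp)]
      simp [outS]
    · simp
  | step m m' x _ hs ih =>
    obtain ⟨j, rfl, hj⟩ := ih (fun h => hx (by simp [h]))
    obtain ⟨k, h1, h2⟩ := inv_step hv hu hpost m m' j hj hs (fun h => hx (by simp [h]))
    exact ⟨j + k, by rw [h1, List.replicate_append_replicate], h2⟩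

theorem sound' (hv : ∀ i, v i ≠ []) (hu : ∀ i, u i ≠ []) (hpre : pre ≠ []) (hpost : post ≠ [])
    (k : ℕ) (h : List.replicate k (some true) ∈ obsStickerLang (theSys v u pre post c) obsA) :
    QAcc v u (pre ++ List.replicate k c ++ post) := by
  obtain ⟨m, hr, hc⟩ := (mem_iff_run _ _ _).1 h
  obtain ⟨j, hj, hi⟩ := sound hv hu hpost m _ hr (by simp [List.mem_replicate])
  have : k = j := by simpa using congrArg List.length hj
  subst this
  have hc := (forall₂_fst _ _).1 hc
  rcases hi with ⟨h1, h2, rfl, h4, h5⟩ | ⟨h1, h2, h4, h5⟩ | ⟨n, l, w, h1, h2, h4, h5, h6⟩ |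
      ⟨n, l, i, w, h1, h2, h4, h6⟩ 
  · rw [hc, h5] at h4; simp at h4; exact absurd h4 hpre
  · rw [hc, h5] at h4; simp at h4; exact absurd h4.1 hpre
  · rw [hc] at h4; simp at h4; exact absurd h4 h5
  · rw [hc] at h4; simp at h4; subst h4
    exact ⟨i, by simpa using h6⟩

theorem Run.dom {m : Molecule (SW Q I)} {x} (h : Run (theSys v u pre post c) obsA m x)
    (d : Molecule (SW Q I)) (hd : d ∈ (theSys v u pre post c).dominoes) (w)
    (hw : (m.1 ++ d.1).map Prod.fst = (m.2 ++ d.2).map Prod.fst ++ w) (o)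
    (ho : outS (fA (fA .ini m.1) d.1, fB (fB (0, none) m.2) d.2) = o) :
    Run (theSys v u pre post c) obsA (m.1 ++ d.1, m.2 ++ d.2) (x ++ o.toList) := by
  subst ho
  have := Run.step _ (m.1 ++ d.1, m.2 ++ d.2) _ h ⟨d, hd, rfl, ws_of _ w hw⟩
  rw [obs_le, fA_append, fB_append] at this
  · exact this
  · have := congrArg List.length hw
    simp at this ⊢
    omega

theorem comp_inp (k : ℕ) : ∃ y, Run (theSys v u pre post c) obsA (y, []) (List.replicate k (some true)) ∧
    (fA .ini y = .ini ∨ fA .ini y = .inp) ∧ y.map Prod.fst = pre ++ List.replicate k c := by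
  induction k with
  | zero =>
    refine ⟨nilW pre, ?_, by simp, by simp⟩
    have := Run.ax (γ := theSys v u pre post c) (A := obsA) (nilW pre, []) rfl
    rw [obs_le _ (by simp)] at this
    simpa [fB, outS] using this
  | succ k ih =>
    obtain ⟨y, h1, h2, h3⟩ := ih
    have h4 : fA (fA .ini y) (tagW .inp [c]) = .inp := by
      rw [fA_tagW _ _ _ (by simp)]
      rcases h2 with h | h <;> simp [h, dA]
    refine ⟨y ++ tagW .inp [c], ?_, ?_, ?_⟩
    · have := h1.dom (tagW .inp [c], []) (.inl (.inl rfl)) (pre ++ List.replicate k c ++ [c])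
        (by simp [h3]) (some (some true)) (by simp [h4, outS])
      simpa [List.replicate_succ'] using this
    · rw [fA_append, h4]; simp
    · simp [h3, List.replicate_succ']

theorem comp_run (hv : ∀ i, v i ≠ []) (hu : ∀ i, u i ≠ []) (hpost : post ≠ []) (k : ℕ) (w)
    (h : RQ v u (start pre post c k) w) :
    ∃ m n l, Run (theSys v u pre post c) obsA m (List.replicate k (some true)) ∧
      fA .ini m.1 = .run n l ∧ fB (0, none) m.2 = (n, l) ∧
      m.1.map Prod.fst = m.2.map Prod.fst ++ w := by
  induction h with
  | refl =>
    obtain ⟨y, h1, h2, h3⟩ := comp_inp (v := v) (u := u) (pre := pre) (post := post) (c := c) k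
    have h4 : fA (fA .ini y) (tagW .post post) = .run 0 none := by
      rw [fA_tagW _ _ _ hpost]
      rcases h2 with h | h <;> simp [h, dA]
    refine ⟨(y ++ tagW .post post, []), 0, none, ?_, ?_, rfl, ?_⟩
    · have := h1.dom (tagW .post post, []) (.inl (.inr rfl)) (pre ++ List.replicate k c ++ post)
        (by simp [h3]) none (by simp [h4, outS])
      simpa using this
    · rw [fA_append, h4]
    · simp [h3]
  | tail _ hs ih =>
    obtain ⟨m, n, l, h1, h2, h3, h4⟩ := ih
    obtain ⟨i, w', rfl, rfl⟩ := hs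
    have h5 := h1.dom ([], tagW (.tile i) (v i)) (.inr (.inr ⟨i, rfl⟩)) w' (by simp [h4]) none
      (by rw [fB_tagW _ _ _ (hv i), h2, h3]; simp [dB, outS])
    have h6 := h5.dom (tagW (.tile i) (u i), []) (.inr (.inl ⟨i, rfl⟩)) (w' ++ u i)
      (by simp [h4]) none
      (by simp [fA_append, fB_append, fA_tagW, fB_tagW, hv, hu, h2, h3, dA, dB, outS])
    refine ⟨_, n + 1, some i, by simpa using h6, ?_, ?_, ?_⟩
    · simp [fA_append, fA_tagW, hu, h2, dA]
    · simp [fB_append, fB_tagW, hv, h3, dB]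
    · simp [h4]

theorem complete (hv : ∀ i, v i ≠ []) (hu : ∀ i, u i ≠ []) (hpost : post ≠ [])
    (k : ℕ) (h : QAcc v u (pre ++ List.replicate k c ++ post)) :
    List.replicate k (some true) ∈ obsStickerLang (theSys v u pre post c) obsA := by
  obtain ⟨i, h⟩ := h
  obtain ⟨m, n, l, h1, h2, h3, h4⟩ := comp_run hv hu hpost k _ h
  have h5 := h1.dom ([], tagW (.tile i) (v i)) (.inr (.inr ⟨i, rfl⟩)) [] (by simp [h4]) none
      (by rw [fB_tagW _ _ _ (hv i), h2, h3]; simp [dB, outS])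
  refine (mem_iff_run _ _ _).2 ⟨_, by simpa using h5, ?_⟩
  exact (forall₂_fst _ _).2 (by simp [h4])

end stick

theorem repl_comp : Computable (fun k : ℕ => List.replicate k (some true)) := by
  have : Primrec (fun k : ℕ => (List.range k).map fun _ => some true) :=
    Primrec.list_map Primrec.list_range (Primrec.const (some true)).to₂
  refine this.to_comp.of_eq ?_
  intro k
  simp

theorem part3 {Q I : Type} [Finite Q] [Finite I] (v u : I → List Q) (pre post : List Q) (c : Q)
    (hv : ∀ i, v i ≠ []) (hu : ∀ i, u i ≠ []) (hpre : pre ≠ []) (hpost : post ≠ [])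
    (hn : ¬ ComputablePred fun k : ℕ => QAcc v u (pre ++ List.replicate k c ++ post)) :
    ∃ (V : Type) (_ : Finite V) (γ : StickerSystem V)
      (A : List (Option V × Option V) → Option (Option Bool)),
      γ.IsSimpleRegular ∧ ObserverRegular A ∧
      ¬ ComputablePred (fun x => x ∈ obsStickerLang γ A) := by
  have := Tg.finite I
  refine ⟨SW Q I, inferInstance, theSys v u pre post c, obsA, theSys_simple _ _ _ _ _,
    obsA_regular, fun h => hn ?_⟩
  refine ComputablePred.computable_of_manyOneReducible
    ⟨fun k => List.replicate k (some true), repl_comp, fun k => ?_⟩ h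
  exact ⟨complete hv hu hpost k, sound' hv hu hpre hpost k⟩

/-- There is an observable sticker system `φ = (γ, A)`, with `γ` a simple
regular sticker system, whose unfiltered language `L(φ)` (a language over `Σ ∪ {⊥}`, here
with `Σ = Bool`) is not recursive, i.e. membership in it is not decidable. -/
theorem exists_obsStickerLang_not_recursive :
    ∃ (V : Type) (_ : Finite V) (γ : StickerSystem V)
      (A : List (Option V × Option V) → Option (Option Bool)),
      γ.IsSimpleRegular ∧ ObserverRegular A ∧
      ¬ ComputablePred (fun x => x ∈ obsStickerLang γ A) := by
  obtain ⟨Γ, Λ, _, _, _, M, S, X, B, C, hS, ss, hn⟩ := part1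
  obtain ⟨Q, I, _, _, v, u, pre, post, c, hv, hu, hpre, hpost, hn2⟩ := part2 M S X B C hS ss hn
  exact part3 v u pre post c hv hu hpre hpost hn2
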